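/- Let A be a primitive set and p a prime such that every prime dividing some element of A'_p = {a ∈ A : least prime factor of a equals p} is a Zhang prime, where a prime q is Zhang if ∑_{r prime, r ≥ q} 1/(r·log r) ≤ 1/log q. Then f(A'_p) ≤ 1/(p·log p). Consequently, if every prime dividing some element of A is Zhang, then f(A) ≤ ∑_{q prime} 1/(q·log q). -/

import Mathlib

open scoped BigOperators

/-- A set of positive integers is *primitive* if every element exceeds 1 and
no element divides another element. -/
def IsPrimitive (A : Set ℕ) : Prop :=
  (∀ a ∈ A, 1 < a) ∧ ∀ a ∈ A, ∀ b ∈ A, a ≠ b → ¬ a ∣ b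

/-- `f A = ∑_{a ∈ A} 1/(a log a)`. -/
noncomputable def f (A : Set ℕ) : ℝ :=
  ∑' a : A, 1 / ((a : ℕ) * Real.log (a : ℕ))

/-- A prime `q` is *Zhang* if `∑_{r prime, r ≥ q} 1/(r log r) ≤ 1/log q`. -/
def IsZhang (q : ℕ) : Prop :=
  ∑' r : {r : ℕ // r.Prime ∧ q ≤ r}, 1 / ((r : ℕ) * Real.log (r : ℕ)) ≤
    1 / Real.log q

/-- The sum of `1 / (p log p)` over the primes in the dyadic interval `[2 ^ k, 2 ^ (k + 1))`
is `O(1 / k ^ 2)`. -/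
theorem sum_primes_dyadic_le {k : ℕ} (hk : 0 < k) :
    ∑ p ∈ Finset.Ico (2 ^ k : ℕ) (2 ^ (k + 1)) with p.Prime, 1 / ((p : ℝ) * Real.log p) ≤
      6 / (k : ℝ) ^ 2 := by
  have hl : 0 < Real.log 2 := Real.log_pos one_lt_two
  have hk' : (0 : ℝ) < k := by exact_mod_cast hk
  calc ∑ p ∈ Finset.Ico (2 ^ k : ℕ) (2 ^ (k + 1)) with p.Prime, 1 / ((p : ℝ) * Real.log p)
      ≤ ∑ p ∈ Finset.Ico (2 ^ k : ℕ) (2 ^ (k + 1)) with p.Prime,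
          Real.log p / (2 ^ k * (k * Real.log 2) ^ 2) := by
        refine Finset.sum_le_sum fun p hp => ?_
        simp only [Finset.mem_filter, Finset.mem_Ico] at hp
        have h2 : (2 : ℝ) ^ k ≤ p := by exact_mod_cast hp.1.1
        have hlog : k * Real.log 2 ≤ Real.log p := by
          rw [← Real.log_pow]
          exact Real.log_le_log (by positivity) h2
        have hp0 : (0 : ℝ) < p := by exact_mod_cast hp.2.pos
        have hlp : 0 < Real.log p := lt_of_lt_of_le (by positivity) hlog
        rw [div_le_div_iff₀ (by positivity) (by positivity)]
        calc 1 * ((2 : ℝ) ^ k * (k * Real.log 2) ^ 2) ≤ p * Real.log p ^ 2 := by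
              rw [one_mul]; gcongr
          _ = Real.log p * (p * Real.log p) := by ring
    _ ≤ Chebyshev.theta ((2 ^ (k + 1) : ℕ) : ℝ) / (2 ^ k * (k * Real.log 2) ^ 2) := by
        rw [← Finset.sum_div]
        gcongr
        rw [Chebyshev.theta, Nat.floor_natCast]
        refine Finset.sum_le_sum_of_subset_of_nonneg ?_ fun p _ _ => Real.log_natCast_nonneg p
        intro p hp
        simp only [Finset.mem_filter, Finset.mem_Ico, Finset.mem_Ioc] at hp ⊢
        exact ⟨⟨hp.2.pos, hp.1.2.le⟩, hp.2⟩
    _ ≤ Real.log 4 * ((2 ^ (k + 1) : ℕ) : ℝ) / (2 ^ k * (k * Real.log 2) ^ 2) := by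
        gcongr
        exact Chebyshev.theta_le_log4_mul_x (by positivity)
    _ = 4 / Real.log 2 / (k : ℝ) ^ 2 := by
        have h4 : Real.log 4 = 2 * Real.log 2 := by
          rw [show (4 : ℝ) = 2 ^ 2 by norm_num, Real.log_pow]; norm_num
        rw [h4]
        push_cast
        field_simp
        ring
    _ ≤ 6 / (k : ℝ) ^ 2 := by
        gcongr
        rw [div_le_iff₀ hl]
        linarith [Real.log_two_gt_d9]

theorem sum_primes_range_two_pow_le {K : ℕ} (hK : 1 ≤ K) :
    ∑ p ∈ Finset.range (2 ^ K) with p.Prime, 1 / ((p : ℝ) * Real.log p) ≤ 12 - 12 / (K : ℝ) := by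
  induction K, hK using Nat.le_induction with
  | base =>
    rw [Finset.sum_filter]
    simp [Finset.sum_range_succ]
  | succ K hK ih =>
    have hstep := sum_primes_dyadic_le hK
    have hsplit : ∑ p ∈ Finset.range (2 ^ (K + 1)) with p.Prime, 1 / ((p : ℝ) * Real.log p) =
        ∑ p ∈ Finset.range (2 ^ K) with p.Prime, 1 / ((p : ℝ) * Real.log p) +
        ∑ p ∈ Finset.Ico (2 ^ K : ℕ) (2 ^ (K + 1)) with p.Prime, 1 / ((p : ℝ) * Real.log p) := by
      simp only [Finset.sum_filter]
      rw [Finset.sum_range_add_sum_Ico _ (Nat.pow_le_pow_right two_pos K.le_succ)]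
    have hK' : (1 : ℝ) ≤ K := by exact_mod_cast hK
    have htel : 6 / (K : ℝ) ^ 2 ≤ 12 / K - 12 / ((K + 1 : ℕ) : ℝ) := by
      push_cast
      rw [div_sub_div _ _ (by positivity) (by positivity),
        div_le_div_iff₀ (by positivity) (by positivity)]
      nlinarith [mul_nonneg (sub_nonneg.2 hK') (sq_nonneg (K : ℝ)), sq_nonneg (K : ℝ)]
    linarith

theorem one_div_mul_log_nonneg (n : ℕ) : 0 ≤ 1 / ((n : ℝ) * Real.log n) :=
  one_div_nonneg.2 (mul_nonneg n.cast_nonneg (Real.log_natCast_nonneg n))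

theorem summable_primes_one_div_mul_log :
    Summable fun p : {p : ℕ // p.Prime} => 1 / ((p : ℕ) * Real.log (p : ℕ)) := by
  refine (summable_subtype_iff_indicator
    (f := fun n : ℕ => 1 / ((n : ℝ) * Real.log n)) (s := {p : ℕ | p.Prime})).2 ?_
  refine summable_of_sum_range_le (c := 12)
    (fun n => Set.indicator_nonneg (fun n _ => one_div_mul_log_nonneg n) n) fun n => ?_
  calc ∑ i ∈ Finset.range n,
        Set.indicator {p : ℕ | p.Prime} (fun n : ℕ => 1 / ((n : ℝ) * Real.log n)) i
      = ∑ p ∈ Finset.range n with p.Prime, 1 / ((p : ℝ) * Real.log p) := by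
        simp only [Finset.sum_filter, Set.indicator_apply, Set.mem_ofPred_eq]
    _ ≤ ∑ p ∈ Finset.range (2 ^ (n + 1)) with p.Prime, 1 / ((p : ℝ) * Real.log p) := by
        refine Finset.sum_le_sum_of_subset_of_nonneg
          (Finset.filter_subset_filter _ (Finset.range_mono ?_))
          fun p _ _ => one_div_mul_log_nonneg p
        exact (n.lt_two_pow_self.trans (Nat.pow_lt_pow_right one_lt_two n.lt_succ_self)).le
    _ ≤ 12 - 12 / ((n + 1 : ℕ) : ℝ) := sum_primes_range_two_pow_le (Nat.le_add_left 1 n)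
    _ ≤ 12 := sub_le_self _ (by positivity)

/-- A finite sum of `1 / (r log r)` over primes satisfying `P` is at most the full sum. -/
theorem sum_primes_le_tsum (P : ℕ → Prop) (R : Finset ℕ) (hR : ∀ r ∈ R, r.Prime ∧ P r) :
    ∑ r ∈ R, 1 / ((r : ℝ) * Real.log r) ≤
      ∑' r : {r : ℕ // r.Prime ∧ P r}, 1 / ((r : ℕ) * Real.log (r : ℕ)) := by
  have hs : Summable fun r : {r : ℕ // r.Prime ∧ P r} => 1 / ((r : ℕ) * Real.log (r : ℕ)) :=
    summable_primes_one_div_mul_log.comp_injective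
      (i := fun r : {r : ℕ // r.Prime ∧ P r} => (⟨r, r.2.1⟩ : {p : ℕ // p.Prime}))
      fun a b hab => Subtype.ext (congrArg (fun p : {p : ℕ // p.Prime} => (p : ℕ)) hab)
  classical
  rw [← Finset.sum_subtype_of_mem (fun r : ℕ => 1 / ((r : ℝ) * Real.log r)) hR]
  exact hs.sum_le_tsum _ fun r _ => one_div_mul_log_nonneg r

/-- If all primes dividing elements of a primitive finite set `F` are Zhang, and every element of
`F` is `n` times an integer free of prime factors below a prime factor `q` of `n`, then
`f F ≤ 1 / (n log q)`. -/
theorem sum_le_of_forall_isZhang {n q : ℕ} (hq : q.Prime) (hn : 0 < n) (hqn : q ∣ n)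
    {F : Finset ℕ} (hpos : ∀ a ∈ F, 0 < a)
    (hprim : ∀ a ∈ F, ∀ b ∈ F, a ≠ b → ¬ a ∣ b)
    (hZ : ∀ r : ℕ, r.Prime → (∃ a ∈ F, r ∣ a) → IsZhang r)
    (hF : ∀ a ∈ F, ∃ b, a = n * b ∧ ∀ r : ℕ, r.Prime → r ∣ b → q ≤ r) :
    ∑ a ∈ F, 1 / ((a : ℝ) * Real.log a) ≤ 1 / (n * Real.log q) := by
  obtain ⟨k, hk⟩ : ∃ k, ∀ a ∈ F, a < n + k :=
    ⟨F.sup id + 1, fun a ha => by have := Finset.le_sup (f := id) ha; simp only [id] at this; omega⟩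
  induction k generalizing n q F with
  | zero =>
    have hempty : F = ∅ := Finset.eq_empty_of_forall_notMem fun a ha => by
      obtain ⟨b, rfl, -⟩ := hF a ha
      exact absurd (hk _ ha)
        (not_lt.2 (Nat.le_mul_of_pos_right n (Nat.pos_of_mul_pos_left (hpos _ ha))))
    rw [hempty, Finset.sum_empty]
    exact one_div_nonneg.2 (mul_nonneg n.cast_nonneg (Real.log_natCast_nonneg q))
  | succ k ih =>
    have hlq : 0 < Real.log q := Real.log_pos (by exact_mod_cast hq.one_lt)
    have hn' : (0 : ℝ) < n := by exact_mod_cast hn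
    rcases F.eq_empty_or_nonempty with rfl | ⟨a₀, ha₀⟩
    · rw [Finset.sum_empty]
      positivity
    have hna : ∀ a ∈ F, n ∣ a := fun a ha => (hF a ha).imp fun b hb => hb.1
    by_cases hnF : n ∈ F
    · have hsing : F = {n} := Finset.eq_singleton_iff_unique_mem.2
        ⟨hnF, fun a ha => by_contra fun hne => hprim n hnF a ha (Ne.symm hne) (hna a ha)⟩
      rw [hsing, Finset.sum_singleton]
      have : (0 : ℝ) < q := by exact_mod_cast hq.pos
      gcongr
      exact Nat.le_of_dvd hn hqn
    have hdecomp : ∀ a ∈ F, (a / n).minFac.Prime ∧ q ≤ (a / n).minFac ∧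
        n * (a / n).minFac ∣ a ∧ ∀ s : ℕ, s.Prime → s ∣ a / (n * (a / n).minFac) →
          (a / n).minFac ≤ s := by
      intro a ha
      obtain ⟨b, rfl, hb⟩ := hF a ha
      rw [Nat.mul_div_cancel_left b hn, Nat.mul_div_mul_left _ _ hn]
      have hb1 : b ≠ 1 := by
        rintro rfl
        exact hnF (by simpa using ha)
      refine ⟨Nat.minFac_prime hb1, hb _ (Nat.minFac_prime hb1) b.minFac_dvd,
        mul_dvd_mul_left n b.minFac_dvd, fun s hs hsb => ?_⟩
      exact Nat.minFac_le_of_dvd hs.two_le (hsb.trans (Nat.div_dvd_of_dvd b.minFac_dvd))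
    calc ∑ a ∈ F, 1 / ((a : ℝ) * Real.log a)
        = ∑ r ∈ F.image fun a => (a / n).minFac,
            ∑ a ∈ F with (a / n).minFac = r, 1 / ((a : ℝ) * Real.log a) :=
          (Finset.sum_fiberwise_of_maps_to (fun a ha => Finset.mem_image_of_mem _ ha) _).symm
      _ ≤ ∑ r ∈ F.image fun a => (a / n).minFac, 1 / ((n * r : ℕ) * Real.log r) := by
          refine Finset.sum_le_sum fun r hr => ?_
          obtain ⟨a₁, ha₁, rfl⟩ := Finset.mem_image.1 hr
          have hsub : (F.filter fun a => (a / n).minFac = (a₁ / n).minFac) ⊆ F :=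
            Finset.filter_subset _ _
          have hrp := (hdecomp a₁ ha₁).1
          refine ih hrp (Nat.mul_pos hn hrp.pos) (dvd_mul_left _ n)
            (fun a ha => hpos a (hsub ha))
            (fun a ha b hb => hprim a (hsub ha) b (hsub hb))
            (fun s hs ⟨a, ha, hsa⟩ => hZ s hs ⟨a, hsub ha, hsa⟩)
            (fun a ha => ?_) fun a ha => ?_
          · obtain ⟨haF, har⟩ := Finset.mem_filter.1 ha
            obtain ⟨-, -, h1, h2⟩ := hdecomp a haF
            rw [← har]
            exact ⟨_, (Nat.mul_div_cancel' h1).symm, h2⟩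
          · have h1 := hk a (hsub ha)
            have h2 : n * 2 ≤ n * (a₁ / n).minFac := Nat.mul_le_mul_left n hrp.two_le
            omega
      _ = 1 / n * ∑ r ∈ F.image fun a => (a / n).minFac, 1 / ((r : ℝ) * Real.log r) := by
          rw [Finset.mul_sum]
          refine Finset.sum_congr rfl fun r _ => ?_
          rw [one_div_mul_one_div, Nat.cast_mul, mul_assoc]
      _ ≤ 1 / n * (1 / Real.log q) := by
          gcongr
          refine (sum_primes_le_tsum (q ≤ ·) _ fun r hr => ?_).trans
            (hZ q hq ⟨a₀, ha₀, hqn.trans (hna a₀ ha₀)⟩)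
          obtain ⟨a, ha, rfl⟩ := Finset.mem_image.1 hr
          exact ⟨(hdecomp a ha).1, (hdecomp a ha).2.1⟩
      _ = 1 / (n * Real.log q) := one_div_mul_one_div _ _

theorem sum_le_of_forall_minFac_eq {p : ℕ} (hp : p.Prime) {F : Finset ℕ}
    (hpos : ∀ a ∈ F, 0 < a) (hprim : ∀ a ∈ F, ∀ b ∈ F, a ≠ b → ¬ a ∣ b)
    (hZ : ∀ r : ℕ, r.Prime → (∃ a ∈ F, r ∣ a) → IsZhang r) (hF : ∀ a ∈ F, a.minFac = p) :
    ∑ a ∈ F, 1 / ((a : ℝ) * Real.log a) ≤ 1 / (p * Real.log p) := by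
  refine sum_le_of_forall_isZhang hp hp.pos dvd_rfl hpos hprim hZ fun a ha => ?_
  obtain ⟨b, hb⟩ := hF a ha ▸ a.minFac_dvd
  refine ⟨b, hb, fun r hr hrb => ?_⟩
  rw [← hF a ha]
  exact Nat.minFac_le_of_dvd hr.two_le (hrb.trans ⟨p, by rw [hb, mul_comm]⟩)

theorem f_le_of_forall_finset {A : Set ℕ} {c : ℝ}
    (h : ∀ F : Finset ℕ, (∀ a ∈ F, a ∈ A) → ∑ a ∈ F, 1 / ((a : ℝ) * Real.log a) ≤ c) :
    f A ≤ c := by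
  refine Real.tsum_le_of_sum_le (fun a => one_div_mul_log_nonneg a) fun u => ?_
  have := h (u.map (Function.Embedding.subtype _)) fun a ha => by
    obtain ⟨b, -, rfl⟩ := Finset.mem_map.1 ha
    exact b.2
  rwa [Finset.sum_map] at this

theorem zhang_primes_erdos (A : Set ℕ) (hA : IsPrimitive A) :
    (∀ p : ℕ, p.Prime →
      (∀ q : ℕ, q.Prime → (∃ a ∈ A, a.minFac = p ∧ q ∣ a) → IsZhang q) →
      f {a ∈ A | a.minFac = p} ≤ 1 / (p * Real.log p)) ∧
    ((∀ q : ℕ, q.Prime → (∃ a ∈ A, q ∣ a) → IsZhang q) →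
      f A ≤ ∑' p : {p : ℕ // p.Prime}, 1 / ((p : ℕ) * Real.log (p : ℕ))) := by
  obtain ⟨hgt, hprim⟩ := hA
  refine ⟨fun p hp hZ => f_le_of_forall_finset fun F hF => ?_,
    fun hZ => f_le_of_forall_finset fun F hF => ?_⟩
  · exact sum_le_of_forall_minFac_eq hp (fun a ha => zero_lt_one.trans (hgt a (hF a ha).1))
      (fun a ha b hb => hprim a (hF a ha).1 b (hF b hb).1)
      (fun r hr ⟨a, ha, hra⟩ => hZ r hr ⟨a, (hF a ha).1, (hF a ha).2, hra⟩)
      fun a ha => (hF a ha).2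
  · have hprime : ∀ a ∈ F, a.minFac.Prime := fun a ha => Nat.minFac_prime (hgt a (hF a ha)).ne'
    rw [← Finset.sum_fiberwise_of_maps_to (fun a ha => Finset.mem_image_of_mem Nat.minFac ha)]
    refine (Finset.sum_le_sum (g := fun p : ℕ => 1 / ((p : ℝ) * Real.log p)) fun p hp => ?_).trans ?_
    · obtain ⟨a₁, ha₁, rfl⟩ := Finset.mem_image.1 hp
      have hsub : ∀ a ∈ F.filter fun a => a.minFac = a₁.minFac, a ∈ A :=
        fun a ha => hF a (Finset.mem_filter.1 ha).1
      exact sum_le_of_forall_minFac_eq (hprime a₁ ha₁)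
        (fun a ha => zero_lt_one.trans (hgt a (hsub a ha)))
        (fun a ha b hb => hprim a (hsub a ha) b (hsub b hb))
        (fun r hr ⟨a, ha, hra⟩ => hZ r hr ⟨a, hsub a ha, hra⟩)
        fun a ha => (Finset.mem_filter.1 ha).2
    · have hR : ∀ p ∈ F.image Nat.minFac, p.Prime := fun p hp => by
        obtain ⟨a, ha, rfl⟩ := Finset.mem_image.1 hp
        exact hprime a ha
      rw [← Finset.sum_subtype_of_mem (fun p : ℕ => 1 / ((p : ℝ) * Real.log p)) hR]
      exact summable_primes_one_div_mul_log.sum_le_tsum _ fun p _ => one_div_mul_log_nonneg p
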